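/- Let B be an infinite Blaschke product with zeros {a_k}_{k=1}^∞ in 𝔻 \ {0} satisfying Σ_k (1 − |a_k|) < ∞, let B_n be its n-th partial product and g_n = B/B_n its n-th tail product. Then for each p > 1 there holds ρ_p(g_n, 1) ≤ p · C_2^{1/(2p)} · (∫₀^{2π} |B*(e^{iθ}) − B_n*(e^{iθ})|² dθ/2π)^{1/(2p)}, where C_2 is the constant of the Hardy–Littlewood maximal inequality for H², and B*, B_n* are the radial boundary functions. -/

import Mathlib

open MeasureTheory Filter Set
open scoped ENNReal Topology Real NNReal

noncomputable section

/-- The open unit disk in the complex plane. -/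
def unitDisk : Set ℂ := Metric.ball 0 1

/-- The point `r·e^{iθ}`. -/
def circlePt (r θ : ℝ) : ℂ := (r : ℂ) * Complex.exp (θ * Complex.I)

/-- The maximal radial function `Mf(θ) = sup_{0 ≤ r < 1} |f(r e^{iθ})|`, valued in `ℝ≥0∞`. -/
def maxRad (f : ℂ → ℂ) (θ : ℝ) : ℝ≥0∞ :=
  ⨆ r ∈ Set.Ico (0 : ℝ) 1, (‖f (circlePt r θ)‖₊ : ℝ≥0∞)

/-- `log⁺` on `ℝ≥0∞`. -/
def elogPlus (x : ℝ≥0∞) : ℝ≥0∞ :=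
  if x = ∞ then ∞ else ENNReal.ofReal (Real.log x.toReal)

/-- `x ↦ log (1 + x)` on `ℝ≥0∞`. -/
def elog1p (x : ℝ≥0∞) : ℝ≥0∞ :=
  if x = ∞ then ∞ else ENNReal.ofReal (Real.log (1 + x.toReal))

/-- The radial boundary value `f*(e^{iθ}) = lim_{r→1⁻} f(r e^{iθ})`
(a junk value is returned where the limit does not exist). -/
def radialLimit (f : ℂ → ℂ) (θ : ℝ) : ℂ :=
  limUnder (nhdsWithin (1 : ℝ) (Set.Iio 1)) fun r : ℝ => f (circlePt r θ)

/-- The class `M^p`: holomorphic functions on the unit disk with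
`∫₀^{2π} (log⁺ Mf(θ))^p dθ/2π < ∞`. -/
def MpClass (p : ℝ) : Set (ℂ → ℂ) :=
  {f | DifferentiableOn ℂ f unitDisk ∧
    (∫⁻ θ in Set.Ioc 0 (2 * π), elogPlus (maxRad f θ) ^ p) / ENNReal.ofReal (2 * π) < ∞}

/-- The metric `ρ_p` on `M^p`. -/
def rhoMetric (p : ℝ) (f g : ℂ → ℂ) : ℝ≥0∞ :=
  ((∫⁻ θ in Set.Ioc 0 (2 * π), elog1p (maxRad (f - g) θ) ^ p) /
    ENNReal.ofReal (2 * π)) ^ (1 / p)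

/-- The Privalov class `N^p`: holomorphic functions on the unit disk with
`sup_{0≤r<1} ∫₀^{2π} (log⁺|f(re^{iθ})|)^p dθ/2π < ∞`. -/
def NpClass (p : ℝ) : Set (ℂ → ℂ) :=
  {f | DifferentiableOn ℂ f unitDisk ∧
    (⨆ r ∈ Set.Ico (0 : ℝ) 1,
      (∫⁻ θ in Set.Ioc 0 (2 * π),
        ENNReal.ofReal (Real.log ‖f (circlePt r θ)‖) ^ p) / ENNReal.ofReal (2 * π)) < ∞}

/-- The metric `d_p` on `N^p`, defined via boundary values. -/
def dMetric (p : ℝ) (f g : ℂ → ℂ) : ℝ≥0∞ :=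
  ((∫⁻ θ in Set.Ioc 0 (2 * π),
      ENNReal.ofReal (Real.log (1 + ‖radialLimit f θ - radialLimit g θ‖)) ^ p) /
    ENNReal.ofReal (2 * π)) ^ (1 / p)

/-- The Hardy space `H^p`. -/
def HpClass (p : ℝ) : Set (ℂ → ℂ) :=
  {f | DifferentiableOn ℂ f unitDisk ∧
    (⨆ r ∈ Set.Ico (0 : ℝ) 1,
      (∫⁻ θ in Set.Ioc 0 (2 * π), (‖f (circlePt r θ)‖₊ : ℝ≥0∞) ^ p) /
        ENNReal.ofReal (2 * π)) < ∞}

/-- The Smirnov class `N⁺`. -/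
def SmirnovClass : Set (ℂ → ℂ) :=
  {f | DifferentiableOn ℂ f unitDisk ∧
    (∫⁻ θ in Set.Ioc 0 (2 * π), ENNReal.ofReal (Real.log ‖radialLimit f θ‖)) /
      ENNReal.ofReal (2 * π) < ∞ ∧
    Tendsto
      (fun r : ℝ => (∫⁻ θ in Set.Ioc 0 (2 * π),
        ENNReal.ofReal (Real.log ‖f (circlePt r θ)‖)) / ENNReal.ofReal (2 * π))
      (nhdsWithin (1 : ℝ) (Set.Iio 1))
      (nhds ((∫⁻ θ in Set.Ioc 0 (2 * π),
        ENNReal.ofReal (Real.log ‖radialLimit f θ‖)) / ENNReal.ofReal (2 * π)))}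

/-- The normalized Blaschke factor `(|a|/a)·(a − z)/(1 − conj a · z)`. -/
def blaschkeFactor (a z : ℂ) : ℂ :=
  ((‖a‖ : ℂ) / a) * ((a - z) / (1 - (starRingEnd ℂ) a * z))

/-- `B` is a (finite or infinite) Blaschke product on the unit disk. -/
def IsBlaschkeProduct (B : ℂ → ℂ) : Prop :=
  ∃ m : ℕ,
    (∃ n : ℕ, ∃ a : ℕ → ℂ, (∀ k < n, a k ∈ unitDisk ∧ a k ≠ 0) ∧
      ∀ z ∈ unitDisk, B z = z ^ m * ∏ k ∈ Finset.range n, blaschkeFactor (a k) z) ∨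
    (∃ a : ℕ → ℂ, (∀ k, a k ∈ unitDisk ∧ a k ≠ 0) ∧ (Summable fun k => 1 - ‖a k‖) ∧
      ∀ z ∈ unitDisk, B z = z ^ m * ∏' k, blaschkeFactor (a k) z)

/-- `I` is an ideal of the ring `M^p`. -/
structure IsIdealIn (p : ℝ) (I : Set (ℂ → ℂ)) : Prop where
  subset : I ⊆ MpClass p
  zero_mem : (0 : ℂ → ℂ) ∈ I
  add_mem : ∀ f ∈ I, ∀ g ∈ I, f + g ∈ I
  neg_mem : ∀ f ∈ I, -f ∈ I
  mul_mem : ∀ f ∈ MpClass p, ∀ g ∈ I, f * g ∈ I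

/-- `I` is a prime ideal of the ring `M^p`: an ideal such that whenever a product of two
elements of `M^p` lies in `I`, one of the factors lies in `I`. -/
def IsPrimeIdealIn (p : ℝ) (I : Set (ℂ → ℂ)) : Prop :=
  IsIdealIn p I ∧ ∀ f ∈ MpClass p, ∀ g ∈ MpClass p, f * g ∈ I → f ∈ I ∨ g ∈ I

/-- `I` is a dense subset of the metric space `(M^p, ρ_p)`. -/
def IsDenseIn (p : ℝ) (I : Set (ℂ → ℂ)) : Prop :=
  ∀ f ∈ MpClass p, ∀ ε : ℝ≥0∞, 0 < ε → ∃ g ∈ I, rhoMetric p f g < ε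

/-- `I` is an ideal of the ring `N^p`. -/
structure IsIdealInNp (p : ℝ) (I : Set (ℂ → ℂ)) : Prop where
  subset : I ⊆ NpClass p
  zero_mem : (0 : ℂ → ℂ) ∈ I
  add_mem : ∀ f ∈ I, ∀ g ∈ I, f + g ∈ I
  neg_mem : ∀ f ∈ I, -f ∈ I
  mul_mem : ∀ f ∈ NpClass p, ∀ g ∈ I, f * g ∈ I

/-- `I` is a prime ideal of the ring `N^p`. -/
def IsPrimeIdealInNp (p : ℝ) (I : Set (ℂ → ℂ)) : Prop :=
  IsIdealInNp p I ∧ ∀ f ∈ NpClass p, ∀ g ∈ NpClass p, f * g ∈ I → f ∈ I ∨ g ∈ I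

/-- `I` is a dense subset of the metric space `(N^p, d_p)`. -/
def IsDenseInNp (p : ℝ) (I : Set (ℂ → ℂ)) : Prop :=
  ∀ f ∈ NpClass p, ∀ ε : ℝ≥0∞, 0 < ε → ∃ g ∈ I, dMetric p f g < ε


lemma fatou_cauchy_deriv {R : ℂ → ℂ} (hR : DiffContOnCl ℂ R (Metric.ball 0 1)) {z : ℂ}
    (hz : z ∈ Metric.ball (0:ℂ) 1) :
    (∮ ζ in C(0, 1), ((ζ - z) ^ 2)⁻¹ * R ζ) = 2 * π * Complex.I * deriv R z := by
  have hnhds : Metric.ball (0:ℂ) 1 ∈ 𝓝 z := Metric.isOpen_ball.mem_nhds hz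
  have hd : DifferentiableAt ℂ R z := hR.differentiableAt Metric.isOpen_ball hz
  have hQ : DiffContOnCl ℂ (dslope R z) (Metric.ball 0 1) := by
    refine ⟨(Complex.differentiableOn_dslope hnhds).2 hR.differentiableOn, ?_⟩
    refine (continuousOn_dslope (mem_of_superset hnhds subset_closure)).2 ⟨hR.continuousOn, hd⟩
  have h1 := hQ.circleIntegral_sub_inv_smul hz
  have hne : ∀ ζ ∈ Metric.sphere (0:ℂ) 1, ζ ≠ z := by
    rintro ζ hζ rfl
    simp at hζ hz
    linarith
  have hcont : ContinuousOn (fun ζ : ℂ => ((ζ - z) ^ 2)⁻¹) (Metric.sphere 0 1) := by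
    refine ContinuousOn.inv₀ (by fun_prop) ?_
    intro ζ hζ
    exact pow_ne_zero _ (sub_ne_zero.2 (hne ζ hζ))
  have hRs : ContinuousOn R (Metric.sphere 0 1) :=
    hR.continuousOn_ball.mono Metric.sphere_subset_closedBall
  have h2 : (∮ ζ in C(0, 1), (ζ - z)⁻¹ • dslope R z ζ) =
      ∮ ζ in C(0, 1), (((ζ - z) ^ 2)⁻¹ * R ζ - ((ζ - z) ^ 2)⁻¹ * R z) := by
    refine circleIntegral.integral_congr zero_le_one ?_
    intro ζ hζ
    have := sub_ne_zero.2 (hne ζ hζ)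
    simp only [dslope_of_ne _ (hne ζ hζ), slope_def_field, smul_eq_mul]
    field_simp
  have h3 : (∮ ζ in C(0, 1), ((ζ - z) ^ 2)⁻¹ * R z) = 0 := by
    have := circleIntegral.integral_sub_zpow_of_ne (n := -2) (by norm_num) 0 z 1
    have h4 : (∮ ζ in C(0, 1), ((ζ - z) ^ 2)⁻¹) = 0 := by
      rw [← this]; congr 1
    simp_rw [mul_comm _ (R z)]
    rw [circleIntegral.integral_const_mul, h4, mul_zero]
  rw [h1, circleIntegral.integral_sub, h3, sub_zero] at h2
  · rw [← h2]; simp [dslope_same]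
  · exact (hcont.mul hRs).circleIntegrable zero_le_one
  · exact (hcont.mul continuousOn_const).circleIntegrable zero_le_one

lemma fatou_cauchy_zero {R : ℂ → ℂ} (hR : DiffContOnCl ℂ R (Metric.ball 0 1)) {w : ℂ}
    (hw : 1 < ‖w‖) :
    (∮ ζ in C(0, 1), ((ζ - w) ^ 2)⁻¹ * R ζ) = 0 := by
  have hd : DifferentiableOn ℂ (fun ζ : ℂ => ((ζ - w) ^ 2)⁻¹) (Metric.closedBall 0 1) := by
    refine DifferentiableOn.inv (by fun_prop) ?_
    intro ζ hζ
    refine pow_ne_zero _ (sub_ne_zero.2 ?_)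
    rintro rfl
    simp at hζ
    linarith
  have := (hd.mono Metric.closure_ball_subset_closedBall).diffContOnCl.smul hR
  exact this.circleIntegral_eq_zero zero_le_one

lemma fatou_poisson {z : ℂ} (hz : z ∈ Metric.ball (0:ℂ) 1) :
    (∫ θ in (0:ℝ)..2 * π, (1 - ‖z‖ ^ 2) / ‖circleMap 0 1 θ - z‖ ^ 2) = 2 * π := by
  have h : DiffContOnCl ℂ (fun _ : ℂ => (1:ℂ)) (Metric.ball 0 1) := diffContOnCl_const
  have h2 := h.circleAverage_poissonKernel_smul' hz
  rw [Real.circleAverage_def] at h2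
  simp only [sub_zero, norm_circleMap_zero, abs_one, one_pow, Complex.real_smul, mul_one] at h2
  rw [intervalIntegral.integral_ofReal] at h2
  norm_cast at h2
  have := Real.pi_pos
  field_simp at h2
  rw [h2]

lemma fatou_kernel {ζ ζ₀ : ℂ} {r : ℝ} (hr0 : 0 < r) (hr1 : r < 1) (hζ : ‖ζ‖ = 1) (hζ₀ : ‖ζ₀‖ = 1) :
    ‖((ζ - r * ζ₀) ^ 2)⁻¹ - ((ζ - ζ₀ / r) ^ 2)⁻¹‖ ≤ (1 - r ^ 2) / r * (2 / ‖ζ - r * ζ₀‖ ^ 3) ∧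
    ‖ζ - ζ₀‖ ≤ 2 * ‖ζ - r * ζ₀‖ ∧ 0 < ‖ζ - r * ζ₀‖ := by
  have hrn : ‖(r * ζ₀ : ℂ)‖ = r := by simp [hζ₀, abs_of_pos hr0]
  have hd1 : 1 - r ≤ ‖ζ - r * ζ₀‖ := by
    have := norm_sub_norm_le ζ (r * ζ₀); rw [hrn, hζ] at this; exact this
  have hdpos : 0 < ‖ζ - r * ζ₀‖ := by linarith
  have hrz : ‖(r:ℂ) * ζ₀ - ζ₀‖ = 1 - r := by
    have : (r:ℂ) * ζ₀ - ζ₀ = ((r - 1 : ℝ) : ℂ) * ζ₀ := by push_cast; ring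
    rw [this, norm_mul, hζ₀, Complex.norm_real, Real.norm_eq_abs, abs_of_neg (by linarith)]; ring
  have hd2 : ‖ζ - ζ₀‖ ≤ 2 * ‖ζ - r * ζ₀‖ := by
    have : ζ - ζ₀ = (ζ - r * ζ₀) + (r * ζ₀ - ζ₀) := by ring
    have h := norm_add_le (ζ - r * ζ₀) (r * ζ₀ - ζ₀)
    rw [← this, hrz] at h; linarith
  refine ⟨?_, hd2, hdpos⟩
  have hrc : (r:ℂ) ≠ 0 := by exact_mod_cast hr0.ne'
  have hrefl : ‖ζ - ζ₀ / r‖ = ‖ζ - r * ζ₀‖ / r := by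
    have h1 : ‖r * ζ - ζ₀‖ = ‖ζ - r * ζ₀‖ := by
      have e1 : ‖r * ζ - ζ₀‖ ^ 2 = ‖ζ - r * ζ₀‖ ^ 2 := by
        have k1 : Complex.normSq ζ = 1 := by rw [Complex.normSq_eq_norm_sq, hζ]; norm_num
        have k2 : Complex.normSq ζ₀ = 1 := by rw [Complex.normSq_eq_norm_sq, hζ₀]; norm_num
        rw [← Complex.normSq_eq_norm_sq, ← Complex.normSq_eq_norm_sq]
        rw [Complex.normSq_apply] at *
        rw [Complex.normSq_apply]
        simp
        linear_combination (r^2-1) * k1 - (r^2-1)*k2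
      exact (sq_eq_sq₀ (norm_nonneg _) (norm_nonneg _)).1 e1
    have h2 : ζ - ζ₀ / r = (r * ζ - ζ₀) / r := by field_simp
    rw [h2, norm_div, h1, Complex.norm_real, Real.norm_eq_abs, abs_of_pos hr0]
  set d := ‖ζ - r * ζ₀‖ with hd
  have hA : ζ - r * ζ₀ ≠ 0 := norm_pos_iff.1 hdpos
  have hBpos : 0 < ‖ζ - ζ₀ / r‖ := by rw [hrefl]; positivity
  have hB : ζ - ζ₀ / r ≠ 0 := norm_pos_iff.1 hBpos
  have hge : d ≤ ‖ζ - ζ₀ / r‖ := by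
    rw [hrefl, le_div_iff₀ hr0]; nlinarith
  have hform : ((ζ - r * ζ₀) ^ 2)⁻¹ - ((ζ - ζ₀ / r) ^ 2)⁻¹ =
      ((((r ^ 2 - 1) / r : ℝ) : ℂ) * ζ₀) * ((ζ - r * ζ₀) + (ζ - ζ₀ / r)) /
        ((ζ - r * ζ₀) ^ 2 * (ζ - ζ₀ / r) ^ 2) := by
    have e : ((((r ^ 2 - 1) / r : ℝ) : ℂ) * ζ₀) = (ζ - ζ₀ / r) - (ζ - r * ζ₀) := by
      push_cast; field_simp; ring
    rw [e]
    generalize ζ - r * ζ₀ = A at *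
    generalize ζ - ζ₀ / r = B at *
    field_simp
    ring
  rw [hform, norm_div, norm_mul, norm_mul, norm_mul, norm_pow, norm_pow, hζ₀, Complex.norm_real,
    Real.norm_eq_abs, abs_div, abs_of_pos hr0, abs_of_neg (by nlinarith), mul_one]
  have hadd := norm_add_le (ζ - r * ζ₀) (ζ - ζ₀ / r)
  rw [← hd] at *
  set D := ‖ζ - ζ₀ / r‖ with hD
  have hk : 0 ≤ (1 - r ^ 2) / r := by
    apply div_nonneg _ hr0.le; nlinarith
  rw [neg_sub, mul_div_assoc]
  apply mul_le_mul_of_nonneg_left _ hk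
  rw [div_le_div_iff₀ (by positivity) (by positivity)]
  calc _ ≤ (d + D) * d ^ 3 := by gcongr
    _ ≤ (D + D) * (d ^ 2 * D) := by
        have : d ^ 3 = d ^ 2 * d := by ring
        rw [this]; gcongr
    _ = _ := by ring

lemma fatou_est {R : ℂ → ℂ} (hR : DiffContOnCl ℂ R (Metric.ball 0 1)) {ζ₀ : ℂ} (hζ₀ : ‖ζ₀‖ = 1)
    {r : ℝ} (hr0 : 0 < r) (hr1 : r < 1) {ε C : ℝ} (hε : 0 ≤ ε) (hC : 0 ≤ C)
    (hb : ∀ ζ : ℂ, ‖ζ‖ = 1 → ‖R ζ‖ ≤ ε * ‖ζ - ζ₀‖ + C * ‖ζ - ζ₀‖ ^ 3) :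
    ‖deriv R (r * ζ₀)‖ ≤ 4 * ε / r + (1 - r ^ 2) / r * (16 * C) := by
  have hrn : ‖(r * ζ₀ : ℂ)‖ = r := by simp [hζ₀, abs_of_pos hr0]
  have hz : (r * ζ₀ : ℂ) ∈ Metric.ball (0:ℂ) 1 := by simp [hζ₀, abs_of_pos hr0, hr1]
  have hw : 1 < ‖ζ₀ / r‖ := by
    rw [norm_div, hζ₀, Complex.norm_real, Real.norm_eq_abs, abs_of_pos hr0, lt_div_iff₀ hr0]
    linarith
  have hRs : ContinuousOn R (Metric.sphere 0 1) :=
    hR.continuousOn_ball.mono Metric.sphere_subset_closedBall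
  have hc : ∀ w : ℂ, ‖w‖ ≠ 1 →
      ContinuousOn (fun ζ : ℂ => ((ζ - w) ^ 2)⁻¹) (Metric.sphere 0 1) := by
    intro w hw
    refine ContinuousOn.inv₀ (by fun_prop) ?_
    intro ζ hζ
    refine pow_ne_zero _ (sub_ne_zero.2 ?_)
    rintro rfl
    simp at hζ
    exact hw hζ
  have e1 := fatou_cauchy_deriv hR hz
  have e2 := fatou_cauchy_zero hR hw
  have e3 : (∮ ζ in C(0, 1), (((ζ - r * ζ₀) ^ 2)⁻¹ * R ζ - ((ζ - ζ₀ / r) ^ 2)⁻¹ * R ζ)) =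
      2 * π * Complex.I * deriv R (r * ζ₀) := by
    rw [circleIntegral.integral_sub, e1, e2, sub_zero]
    · exact ((hc _ (by rw [hrn]; exact hr1.ne)).mul hRs).circleIntegrable zero_le_one
    · exact ((hc _ hw.ne').mul hRs).circleIntegrable zero_le_one
  have hpi := Real.pi_pos
  have hcont : Continuous (fun θ : ℝ => (1 - ‖(r * ζ₀ : ℂ)‖ ^ 2) / ‖circleMap 0 1 θ - r * ζ₀‖ ^ 2) := by
    refine Continuous.div (by fun_prop) (by fun_prop) ?_
    intro θ
    exact pow_ne_zero _ (fatou_kernel hr0 hr1 (by simp) hζ₀).2.2.ne'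
  have hbound : ∀ θ : ℝ, ‖deriv (circleMap 0 1) θ •
        (((circleMap 0 1 θ - r * ζ₀) ^ 2)⁻¹ * R (circleMap 0 1 θ) -
        ((circleMap 0 1 θ - ζ₀ / r) ^ 2)⁻¹ * R (circleMap 0 1 θ))‖ ≤
      (4 * ε / r) * ((1 - ‖(r * ζ₀ : ℂ)‖ ^ 2) / ‖circleMap 0 1 θ - r * ζ₀‖ ^ 2) +
        (1 - r ^ 2) / r * (16 * C) := by
    intro θ
    have hn : ‖circleMap 0 1 θ‖ = 1 := by simp
    obtain ⟨k1, k2, k3⟩ := fatou_kernel hr0 hr1 hn hζ₀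
    have hb' := hb _ hn
    generalize circleMap 0 1 θ = ζ at *
    rw [← sub_mul, norm_smul, norm_mul, hrn]
    have hder : ‖deriv (circleMap 0 1) θ‖ = 1 := by simp [deriv_circleMap]
    rw [hder, one_mul]
    have hk : 0 ≤ (1 - r ^ 2) / r := by
      apply div_nonneg _ hr0.le; nlinarith
    set d := ‖ζ - r * ζ₀‖
    calc _ ≤ ((1 - r ^ 2) / r * (2 / d ^ 3)) * (ε * (2 * d) + C * (2 * d) ^ 3) := by
          refine mul_le_mul k1 (hb'.trans ?_) (norm_nonneg _) (by positivity)
          gcongr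
      _ = _ := by field_simp; ring
  have e4 : ‖2 * π * Complex.I * deriv R (r * ζ₀)‖ ≤
      (4 * ε / r) * (2 * π) + (1 - r ^ 2) / r * (16 * C) * (2 * π) := by
    rw [← e3, circleIntegral]
    refine (intervalIntegral.norm_integral_le_of_norm_le Real.two_pi_pos.le
      (Filter.Eventually.of_forall fun θ _ => hbound θ) ?_).trans ?_
    · exact ((hcont.const_mul _).add continuous_const).intervalIntegrable _ _
    · rw [intervalIntegral.integral_add ((hcont.const_mul _).intervalIntegrable _ _)
        (continuous_const.intervalIntegrable _ _), intervalIntegral.integral_const_mul,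
        fatou_poisson hz, intervalIntegral.integral_const]
      simp only [smul_eq_mul, sub_zero]
      apply le_of_eq; ring
  have e5 : ‖2 * π * Complex.I * deriv R (r * ζ₀)‖ = ‖deriv R (r * ζ₀)‖ * (2 * π) := by
    simp [abs_of_pos hpi]; ring
  rw [e5, ← add_mul] at e4
  exact le_of_mul_le_mul_right e4 (by positivity)

/-- The theorem of Fatou for bounded holomorphic functions. -/
lemma fatou_thm {f : ℂ → ℂ} (hf : DifferentiableOn ℂ f (Metric.ball 0 1)) {M : ℝ≥0}
    (hM : ∀ z ∈ Metric.ball (0:ℂ) 1, ‖f z‖₊ ≤ M) :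
    ∀ᵐ θ : ℝ, ∃ L : ℂ, Tendsto (fun r : ℝ => f (r * Complex.exp (θ * Complex.I)))
      (𝓝[<] 1) (𝓝 L) := by
  obtain ⟨F, hF⟩ := hf.isExactOn_ball
  have hLip : LipschitzOnWith M F (Metric.ball 0 1) := by
    refine (convex_ball (0:ℂ) 1).lipschitzOnWith_of_nnnorm_hasDerivWithin_le
      (fun z hz => (hF z hz).hasDerivWithinAt) hM
  obtain ⟨G, hG, hFG⟩ := hLip.extend_finite_dimension
  set K := lipschitzExtensionConstant ℂ * M
  have hGd : ∀ z ∈ Metric.ball (0:ℂ) 1, HasDerivAt G (f z) z := by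
    intro z hz
    refine (hF z hz).congr_of_eventuallyEq ?_
    filter_upwards [Metric.isOpen_ball.mem_nhds hz] with w hw using (hFG hw).symm
  have hGdc : DiffContOnCl ℂ G (Metric.ball 0 1) :=
    ⟨fun z hz => (hGd z hz).differentiableAt.differentiableWithinAt, hG.continuous.continuousOn⟩
  have hh : LipschitzWith (K * 1) (fun θ : ℝ => G (circleMap 0 1 θ)) := by
    refine hG.comp ?_
    simpa using lipschitzWith_circleMap 0 1
  filter_upwards [hh.ae_differentiableAt_real] with θ₀ hθ₀
  set ζ₀ : ℂ := Complex.exp (θ₀ * Complex.I) with hζ₀def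
  have hζ₀ : ‖ζ₀‖ = 1 := Complex.norm_exp_ofReal_mul_I _
  have hζ₀ne : ζ₀ ≠ 0 := by simp [hζ₀def]
  have hcm : circleMap 0 1 θ₀ = ζ₀ := by simp [circleMap, hζ₀def]
  obtain ⟨h', hh'⟩ : ∃ h', HasDerivAt (fun θ : ℝ => G (circleMap 0 1 θ)) h' θ₀ :=
    ⟨_, hθ₀.hasDerivAt⟩
  set L : ℂ := h' / (ζ₀ * Complex.I) with hL
  refine ⟨L, ?_⟩
  set R : ℂ → ℂ := fun ζ => G ζ - G ζ₀ - L * (ζ - ζ₀) with hRdef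
  have hRd : ∀ z ∈ Metric.ball (0:ℂ) 1, HasDerivAt R (f z - L) z := by
    intro z hz
    have := ((hGd z hz).sub_const (G ζ₀)).sub (((hasDerivAt_id z).sub_const ζ₀).const_mul L)
    rw [mul_one] at this
    exact this
  have hRdc : DiffContOnCl ℂ R (Metric.ball 0 1) := by
    refine ⟨fun z hz => (hRd z hz).differentiableAt.differentiableWithinAt, ?_⟩
    have := hG.continuous
    fun_prop
  have hRlip : ∀ ζ, ‖R ζ‖ ≤ (K + ‖L‖) * ‖ζ - ζ₀‖ := by
    intro ζ
    have h1 := hG.dist_le_mul ζ ζ₀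
    rw [dist_eq_norm, dist_eq_norm] at h1
    calc ‖R ζ‖ ≤ ‖G ζ - G ζ₀‖ + ‖L * (ζ - ζ₀)‖ := norm_sub_le _ _
      _ ≤ K * ‖ζ - ζ₀‖ + ‖L‖ * ‖ζ - ζ₀‖ := by rw [norm_mul]; gcongr
      _ = _ := by ring
  -- differentiability along the circle
  have hRθ : HasDerivAt (fun θ : ℝ => R (circleMap 0 1 θ)) 0 θ₀ := by
    have h1 := (hh'.sub_const (G ζ₀)).sub
      (((hasDerivAt_circleMap 0 1 θ₀).sub_const ζ₀).const_mul L)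
    refine h1.congr_deriv ?_
    rw [hcm, hL]; field_simp; ring
  have hsmall : ∀ ε : ℝ, 0 < ε → ∃ δ > 0, ∀ ζ : ℂ, ‖ζ‖ = 1 → ‖ζ - ζ₀‖ < δ →
      ‖R ζ‖ ≤ ε * ‖ζ - ζ₀‖ := by
    intro ε hε
    have hpi := Real.pi_pos
    have h1 := hRθ.isLittleO
    have h2 := h1.def (c := ε / (π / 2)) (by positivity)
    have hR0 : R ζ₀ = 0 := by simp [hRdef]
    simp only [hcm, hR0, sub_zero, smul_zero] at h2
    obtain ⟨δ, hδ, h3⟩ := Metric.eventually_nhds_iff.1 h2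
    refine ⟨δ / (π / 2), by positivity, ?_⟩
    intro ζ hζ hζδ
    have hζne : ζ ≠ 0 := by rintro rfl; simp at hζ
    have hang := Complex.angle_le_mul_norm_sub hζ hζ₀
    rw [Complex.angle_eq_abs_arg hζne hζ₀ne] at hang
    set t := (ζ / ζ₀).arg with ht
    have hζt : circleMap 0 1 (θ₀ + t) = ζ := by
      have h4 : Complex.exp (t * Complex.I) = ζ / ζ₀ := by
        have := Complex.norm_mul_exp_arg_mul_I (ζ / ζ₀)
        rw [norm_div, hζ, hζ₀] at this
        simpa using this
      rw [circleMap]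
      push_cast
      rw [add_mul, Complex.exp_add, h4, ← hζ₀def]
      field_simp
      simp
    have h5 := @h3 (θ₀ + t) (by
      rw [Real.dist_eq, add_sub_cancel_left]
      refine hang.trans_lt ?_
      rw [lt_div_iff₀ (by positivity)] at hζδ
      linarith)
    rw [hζt, add_sub_cancel_left, Real.norm_eq_abs] at h5
    refine h5.trans ?_
    rw [div_mul_eq_mul_div, div_le_iff₀ (by positivity)]
    nlinarith
  rw [Metric.tendsto_nhds]
  intro η hη
  obtain ⟨δ, hδ, hs⟩ := hsmall (η / 16) (by positivity)
  set C : ℝ := (K + ‖L‖) / δ ^ 2 with hCdef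
  have hC : 0 ≤ C := by positivity
  have hb : ∀ ζ : ℂ, ‖ζ‖ = 1 → ‖R ζ‖ ≤ η / 16 * ‖ζ - ζ₀‖ + C * ‖ζ - ζ₀‖ ^ 3 := by
    intro ζ hζ
    rcases lt_or_ge ‖ζ - ζ₀‖ δ with h | h
    · have := hs ζ hζ h
      have : 0 ≤ C * ‖ζ - ζ₀‖ ^ 3 := by positivity
      linarith
    · have h1 : (K + ‖L‖) * ‖ζ - ζ₀‖ ≤ C * ‖ζ - ζ₀‖ ^ 3 := by
        rw [hCdef, div_mul_eq_mul_div, le_div_iff₀ (by positivity)]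
        have : δ ^ 2 ≤ ‖ζ - ζ₀‖ ^ 2 := by gcongr
        calc _ = (K + ‖L‖) * ‖ζ - ζ₀‖ * δ ^ 2 := by ring
          _ ≤ (K + ‖L‖) * ‖ζ - ζ₀‖ * ‖ζ - ζ₀‖ ^ 2 := by gcongr
          _ = _ := by ring
      have := hRlip ζ
      have : 0 ≤ η / 16 * ‖ζ - ζ₀‖ := by positivity
      linarith
  have hlim : Tendsto (fun r : ℝ => 4 * (η / 16) / r + (1 - r ^ 2) / r * (16 * C)) (𝓝[<] 1)
      (𝓝 (4 * (η / 16) / 1 + (1 - 1 ^ 2) / 1 * (16 * C))) := by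
    have : ContinuousAt (fun r : ℝ => 4 * (η / 16) / r + (1 - r ^ 2) / r * (16 * C)) 1 := by
      fun_prop (disch := norm_num)
    exact this.tendsto.mono_left nhdsWithin_le_nhds
  have hlt : 4 * (η / 16) / 1 + (1 - 1 ^ 2) / 1 * (16 * C) < η := by
    norm_num; linarith
  have h0 : ∀ᶠ r : ℝ in 𝓝[<] 1, 0 < r :=
    nhdsWithin_le_nhds (lt_mem_nhds one_pos)
  filter_upwards [hlim.eventually (gt_mem_nhds hlt), h0, self_mem_nhdsWithin] with r hr hr0 hr1
  have hz : (r * ζ₀ : ℂ) ∈ Metric.ball (0:ℂ) 1 := by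
    simpa [hζ₀, abs_of_pos hr0] using hr1
  have := fatou_est hRdc hζ₀ hr0 hr1 (by positivity) hC hb
  rw [(hRd _ hz).deriv] at this
  rw [dist_eq_norm]
  exact this.trans_lt hr

lemma bl_denom_ne {a z : ℂ} (ha : ‖a‖ < 1) (hz : ‖z‖ ≤ 1) : 1 - (starRingEnd ℂ) a * z ≠ 0 := by
  intro h
  have h1 : (starRingEnd ℂ) a * z = 1 := (sub_eq_zero.1 h).symm
  have h2 : ‖a‖ * ‖z‖ = 1 := by
    have := congrArg norm h1
    simpa using this
  nlinarith [norm_nonneg a, norm_nonneg z]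

lemma bl_sq (a z : ℂ) : ‖1 - (starRingEnd ℂ) a * z‖ ^ 2 - ‖a - z‖ ^ 2 =
    (1 - ‖a‖ ^ 2) * (1 - ‖z‖ ^ 2) := by
  simp only [← Complex.normSq_eq_norm_sq, Complex.normSq_apply]
  simp
  ring

lemma bl_norm {a z : ℂ} (ha0 : a ≠ 0) :
    ‖blaschkeFactor a z‖ = ‖a - z‖ / ‖1 - (starRingEnd ℂ) a * z‖ := by
  have : ‖a‖ ≠ 0 := norm_ne_zero_iff.2 ha0
  rw [blaschkeFactor, norm_mul, norm_div, norm_div, Complex.norm_real, norm_norm, div_self this,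
    one_mul]

lemma bl_norm_le {a z : ℂ} (ha0 : a ≠ 0) (ha : ‖a‖ < 1) (hz : ‖z‖ ≤ 1) :
    ‖blaschkeFactor a z‖ ≤ 1 := by
  rw [bl_norm ha0]
  apply div_le_one_of_le₀ _ (norm_nonneg _)
  have h := bl_sq a z
  refine (sq_le_sq₀ (norm_nonneg _) (norm_nonneg _)).1 ?_
  have h1 : 0 ≤ 1 - ‖a‖ ^ 2 := by nlinarith [norm_nonneg a]
  have h2 : 0 ≤ 1 - ‖z‖ ^ 2 := by nlinarith [norm_nonneg z]
  nlinarith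

lemma bl_norm_eq {a z : ℂ} (ha0 : a ≠ 0) (ha : ‖a‖ < 1) (hz : ‖z‖ = 1) :
    ‖blaschkeFactor a z‖ = 1 := by
  rw [bl_norm ha0]
  have h := bl_sq a z
  rw [hz] at h
  have h1 : ‖a - z‖ = ‖1 - (starRingEnd ℂ) a * z‖ := by
    refine (sq_eq_sq₀ (norm_nonneg _) (norm_nonneg _)).1 ?_
    linarith
  rw [h1, div_self (norm_ne_zero_iff.2 (bl_denom_ne ha hz.le))]

lemma bl_sub_one {a z : ℂ} (ha0 : a ≠ 0) (ha : ‖a‖ < 1) {ρ : ℝ} (hρ : ρ < 1) (hz : ‖z‖ ≤ ρ) :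
    ‖blaschkeFactor a z - 1‖ ≤ (1 - ‖a‖) * (2 / (1 - ρ)) := by
  have hd := bl_denom_ne ha (hz.trans hρ.le)
  have hapos : 0 < ‖a‖ := norm_pos_iff.2 ha0
  have hconj : a * (starRingEnd ℂ) a = (‖a‖ : ℂ) ^ 2 := by
    rw [Complex.mul_conj, Complex.normSq_eq_norm_sq]; push_cast; rfl
  have e : blaschkeFactor a z - 1 = -(((1 - ‖a‖ : ℝ) : ℂ) * (a + ‖a‖ * z)) /
      (a * (1 - (starRingEnd ℂ) a * z)) := by
    rw [blaschkeFactor]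
    push_cast
    rw [eq_div_iff (mul_ne_zero ha0 hd)]
    have e1 : (‖a‖ : ℂ) / a * ((a - z) / (1 - (starRingEnd ℂ) a * z)) *
        (a * (1 - (starRingEnd ℂ) a * z)) = ‖a‖ * (a - z) := by
      generalize 1 - (starRingEnd ℂ) a * z = D at hd
      field_simp
    rw [sub_mul, e1]
    linear_combination z * hconj
  have h1 : 1 - ρ ≤ ‖1 - (starRingEnd ℂ) a * z‖ := by
    have h := norm_sub_norm_le 1 ((starRingEnd ℂ) a * z)
    rw [norm_mul, norm_one, RCLike.norm_conj] at h
    nlinarith [norm_nonneg z]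
  have h2 : ‖a + ‖a‖ * z‖ ≤ ‖a‖ * 2 := by
    refine (norm_add_le _ _).trans ?_
    rw [norm_mul, Complex.norm_real, norm_norm]
    nlinarith
  have h3 : 0 < 1 - ρ := by linarith
  have h4 : 0 < 1 - ‖a‖ := by linarith
  rw [e, norm_div, norm_neg, norm_mul, norm_mul, Complex.norm_real, Real.norm_eq_abs,
    abs_of_pos h4, mul_div_assoc]
  refine mul_le_mul_of_nonneg_left ?_ h4.le
  rw [div_le_div_iff₀ (by positivity) h3]
  calc _ ≤ (‖a‖ * 2) * ‖1 - (starRingEnd ℂ) a * z‖ := by gcongr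
    _ = _ := by ring

lemma bl_differentiableAt {a z : ℂ} (ha : ‖a‖ < 1) (hz : ‖z‖ ≤ 1) :
    DifferentiableAt ℂ (blaschkeFactor a) z := by
  have := bl_denom_ne ha hz
  unfold blaschkeFactor
  fun_prop (disch := assumption)

lemma bl_tail {b : ℕ → ℂ} (hb : ∀ k, ‖b k‖ < 1 ∧ b k ≠ 0) (hs : Summable fun k => 1 - ‖b k‖) :
    DifferentiableOn ℂ (fun z => ∏' k, blaschkeFactor (b k) z) (Metric.ball 0 1) ∧
    (∀ z ∈ Metric.ball (0:ℂ) 1, Multipliable fun k => blaschkeFactor (b k) z) ∧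
    (∀ z ∈ Metric.ball (0:ℂ) 1, ‖∏' k, blaschkeFactor (b k) z‖ ≤ 1) := by
  have key : ∀ ρ : ℝ, ρ < 1 → HasProdLocallyUniformlyOn (fun k z => blaschkeFactor (b k) z)
      (fun z => ∏' k, blaschkeFactor (b k) z) (Metric.ball 0 ρ) := by
    intro ρ hρ
    have h := Summable.hasProdLocallyUniformlyOn_nat_one_add
      (f := fun k z => blaschkeFactor (b k) z - 1)
      (Metric.isOpen_ball (x := (0:ℂ)) (ε := ρ)) (hs.mul_right (2 / (1 - ρ)))
      (Eventually.of_forall fun k z hz =>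
        bl_sub_one (hb k).2 (hb k).1 hρ (by simpa using (mem_ball_zero_iff.1 hz).le))
      (fun k z hz => by
        have hz' : ‖z‖ ≤ 1 := ((mem_ball_zero_iff.1 hz).trans hρ).le
        exact ((bl_differentiableAt (hb k).1 hz').continuousAt.sub
          continuousAt_const).continuousWithinAt)
    simpa using h
  have hρ : ∀ z ∈ Metric.ball (0:ℂ) 1, ∃ ρ < 1, z ∈ Metric.ball (0:ℂ) ρ := by
    intro z hz
    obtain ⟨ρ, h1, h2⟩ := exists_between (mem_ball_zero_iff.1 hz)
    exact ⟨ρ, h2, mem_ball_zero_iff.2 h1⟩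
  have hmul : ∀ z ∈ Metric.ball (0:ℂ) 1, Multipliable fun k => blaschkeFactor (b k) z := by
    intro z hz
    obtain ⟨ρ, h1, h2⟩ := hρ z hz
    exact ((key ρ h1).hasProd h2).multipliable
  refine ⟨?_, hmul, ?_⟩
  · intro z hz
    obtain ⟨ρ, h1, h2⟩ := hρ z hz
    have hd : DifferentiableOn ℂ (fun z => ∏' k, blaschkeFactor (b k) z) (Metric.ball 0 ρ) := by
      refine (key ρ h1).differentiableOn (Eventually.of_forall fun s => ?_) Metric.isOpen_ball
      intro w hw
      have hw' : ‖w‖ ≤ 1 := ((mem_ball_zero_iff.1 hw).trans h1).le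
      exact (DifferentiableAt.fun_finsetProd fun k _ =>
        bl_differentiableAt (hb k).1 hw').differentiableWithinAt
    exact (hd.differentiableAt (Metric.isOpen_ball.mem_nhds h2)).differentiableWithinAt
  · intro z hz
    have h : Tendsto (fun s : Finset ℕ => ∏ k ∈ s, blaschkeFactor (b k) z) atTop
        (𝓝 (∏' k, blaschkeFactor (b k) z)) := (hmul z hz).hasProd
    have h2 : Tendsto (fun s : Finset ℕ => ‖∏ k ∈ s, blaschkeFactor (b k) z‖) atTop
      (𝓝 ‖∏' k, blaschkeFactor (b k) z‖) := h.norm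
    refine le_of_tendsto h2 (Eventually.of_forall fun s => ?_)
    rw [norm_prod]
    exact Finset.prod_le_one (fun _ _ => norm_nonneg _) fun k _ =>
      bl_norm_le (hb k).2 (hb k).1 (mem_ball_zero_iff.1 hz).le

lemma elog1p_rpow_le {p : ℝ} (hp : 1 < p) (x : ℝ≥0∞) :
    elog1p x ^ p ≤ ENNReal.ofReal p ^ p * x := by
  have hp0 : 0 < p := by linarith
  rw [elog1p]
  split_ifs with h
  · rw [h, ENNReal.mul_top]
    · exact le_top
    · have : 0 < ENNReal.ofReal p ^ p := ENNReal.rpow_pos (by simpa using hp0) (by simp)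
      exact this.ne'
  · set y := x.toReal with hy
    have hy0 : 0 ≤ y := ENNReal.toReal_nonneg
    have hx : x = ENNReal.ofReal y := (ENNReal.ofReal_toReal h).symm
    have hlog : Real.log (1 + y) ≤ p * y ^ (1 / p) := by
      have h1 : Real.log (1 + y) = p * Real.log ((1 + y) ^ (1 / p)) := by
        rw [Real.log_rpow (by linarith)]; field_simp
      rw [h1]
      refine mul_le_mul_of_nonneg_left ?_ hp0.le
      have hle : (1 + y) ^ (1 / p) ≤ 1 + y ^ (1 / p) := by
        have := Real.rpow_add_le_add_rpow (p := 1 / p) zero_le_one hy0 (by positivity)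
          (by rw [div_le_one hp0]; exact hp.le)
        simpa using this
      have hpos : 0 < (1 + y) ^ (1 / p) := by positivity
      have := Real.log_le_sub_one_of_pos hpos
      linarith
    calc _ ≤ ENNReal.ofReal (p * y ^ (1 / p)) ^ p := by gcongr
      _ = _ := by
        rw [ENNReal.ofReal_mul hp0.le, ENNReal.mul_rpow_of_nonneg _ _ hp0.le, hx,
          ENNReal.ofReal_rpow_of_nonneg (x := y ^ (1 / p)) (by positivity) hp0.le, ← Real.rpow_mul hy0,
          one_div_mul_cancel hp0.ne', Real.rpow_one]

lemma circlePt_norm {r θ : ℝ} (h0 : 0 ≤ r) : ‖circlePt r θ‖ = r := by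
  rw [circlePt, norm_mul, Complex.norm_exp_ofReal_mul_I, Complex.norm_real, Real.norm_eq_abs,
    abs_of_nonneg h0, mul_one]

lemma circlePt_mem {r θ : ℝ} (h0 : 0 ≤ r) (h1 : r < 1) : circlePt r θ ∈ unitDisk := by
  rw [unitDisk, mem_ball_zero_iff, circlePt_norm h0]; exact h1

lemma maxRad_measurable {f : ℂ → ℂ} (hf : ContinuousOn f unitDisk) : Measurable (maxRad f) := by
  apply LowerSemicontinuous.measurable
  unfold maxRad
  refine lowerSemicontinuous_biSup fun r hr => Continuous.lowerSemicontinuous ?_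
  have h1 : Continuous fun θ : ℝ => f (circlePt r θ) := by
    refine hf.comp_continuous ?_ fun θ => circlePt_mem hr.1 hr.2
    unfold circlePt
    fun_prop
  exact ENNReal.continuous_coe.comp h1.nnnorm

lemma avg_le_sqrt {h : ℝ → ℝ≥0∞} (hm : Measurable h) :
    (∫⁻ θ in Set.Ioc 0 (2 * π), h θ) / ENNReal.ofReal (2 * π) ≤
      ((∫⁻ θ in Set.Ioc 0 (2 * π), h θ ^ (2 : ℝ)) / ENNReal.ofReal (2 * π)) ^ (1 / 2 : ℝ) := by
  have hpos : ENNReal.ofReal (2 * π) ≠ 0 := by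
    have := Real.two_pi_pos
    simpa using this
  have hc := ENNReal.lintegral_mul_le_Lp_mul_Lq (volume.restrict (Set.Ioc 0 (2 * π)))
    Real.HolderConjugate.two_two hm.aemeasurable (aemeasurable_const (b := (1 : ℝ≥0∞)))
  simp only [Pi.mul_apply, mul_one, ENNReal.one_rpow, lintegral_const, one_mul,
    Measure.restrict_apply MeasurableSet.univ, univ_inter, Real.volume_Ioc, sub_zero] at hc
  set T := ENNReal.ofReal (2 * π)
  have hT : T ≠ ∞ := ENNReal.ofReal_ne_top
  rw [ENNReal.div_rpow_of_nonneg _ _ (by norm_num)]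
  rw [ENNReal.div_le_iff hpos hT]
  refine hc.trans (le_of_eq ?_)
  have hT2 : T = T ^ (1/2:ℝ) * T ^ (1/2:ℝ) := by
    rw [← ENNReal.rpow_add _ _ hpos hT]; norm_num
  have h0 : T ^ (1/2:ℝ) ≠ 0 := (ENNReal.rpow_pos (pos_iff_ne_zero.2 hpos) hT).ne'
  have h1 : T ^ (1/2:ℝ) ≠ ∞ := ENNReal.rpow_ne_top_of_nonneg (by norm_num) hT
  conv_rhs => rw [hT2, ← mul_assoc]
  congr 1
  rw [← hT2, ENNReal.div_mul_cancel h0 h1]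

/-- With `B` an infinite Blaschke product, `B_n` its `n`-th partial product
and `g_n` its `n`-th tail product, and `C₂` a constant realizing the Hardy–Littlewood maximal
inequality for `H²`, one has
`ρ_p(g_n, 1) ≤ p·C₂^{1/(2p)}·(∫₀^{2π} |B* − B_n*|² dθ/2π)^{1/(2p)}` for every `n`. -/
theorem rho_tail_bound (p : ℝ) (hp : 1 < p)
    (C₂ : ℝ≥0∞)
    (hC₂ : ∀ f ∈ HpClass 2,
      (∫⁻ θ in Set.Ioc 0 (2 * π), maxRad f θ ^ (2 : ℝ)) / ENNReal.ofReal (2 * π) ≤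
        C₂ * ((∫⁻ θ in Set.Ioc 0 (2 * π), (‖radialLimit f θ‖₊ : ℝ≥0∞) ^ (2 : ℝ)) /
          ENNReal.ofReal (2 * π)))
    (a : ℕ → ℂ) (ha : ∀ k, a k ∈ unitDisk ∧ a k ≠ 0)
    (hsum : Summable fun k => 1 - ‖a k‖)
    (B : ℂ → ℂ) (hB : ∀ z ∈ unitDisk, B z = ∏' k, blaschkeFactor (a k) z)
    (Bn : ℕ → ℂ → ℂ)
    (hBn : ∀ n, ∀ z ∈ unitDisk, Bn n z = ∏ k ∈ Finset.range n, blaschkeFactor (a k) z)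
    (g : ℕ → ℂ → ℂ)
    (hg : ∀ n, ∀ z ∈ unitDisk, g n z = ∏' k, blaschkeFactor (a (n + k)) z) :
    ∀ n : ℕ, rhoMetric p (g n) 1 ≤
      ENNReal.ofReal p * C₂ ^ (1 / (2 * p)) *
        ((∫⁻ θ in Set.Ioc 0 (2 * π),
          (‖radialLimit B θ - radialLimit (Bn n) θ‖₊ : ℝ≥0∞) ^ (2 : ℝ)) /
            ENNReal.ofReal (2 * π)) ^ (1 / (2 * p)) := by
  intro n
  have hp0 : 0 < p := by linarith
  have ha' : ∀ k, ‖a k‖ < 1 ∧ a k ≠ 0 := fun k => ⟨mem_ball_zero_iff.1 (ha k).1, (ha k).2⟩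
  have hsn : Summable fun k => 1 - ‖a (n + k)‖ := by
    have := (summable_nat_add_iff n).2 hsum
    simpa [add_comm] using this
  obtain ⟨t1, t2, t3⟩ := bl_tail (fun k => ha' (n + k)) hsn
  have hgd : DifferentiableOn ℂ (g n) unitDisk := t1.congr (hg n)
  have hgle : ∀ z ∈ unitDisk, ‖g n z‖ ≤ 1 := fun z hz => by rw [hg n z hz]; exact t3 z hz
  have hfd : DifferentiableOn ℂ (g n - 1) unitDisk := hgd.sub (differentiableOn_const 1)
  have hpi2 : ENNReal.ofReal (2 * π) ≠ 0 := by
    have := Real.two_pi_pos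
    simpa using this
  -- membership in `H²`
  have hH : g n - 1 ∈ HpClass 2 := by
    refine ⟨hfd, ?_⟩
    refine lt_of_le_of_lt (b := (2:ℝ≥0∞) ^ (2:ℝ)) ?_ (by simp)
    refine iSup₂_le fun r hr => ?_
    refine ENNReal.div_le_of_le_mul ?_
    calc _ ≤ ∫⁻ θ in Set.Ioc 0 (2 * π), (2:ℝ≥0∞) ^ (2:ℝ) := by
          refine lintegral_mono fun θ => ?_
          refine ENNReal.rpow_le_rpow ?_ (by norm_num)
          have h1 : ‖(g n - 1) (circlePt r θ)‖ ≤ 2 := by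
            refine (norm_sub_le _ _).trans ?_
            have := hgle _ (circlePt_mem (θ := θ) hr.1 hr.2)
            simp only [Pi.one_apply, norm_one]
            linarith
          have h2 : ‖(g n - 1) (circlePt r θ)‖₊ ≤ 2 := h1
          exact_mod_cast h2
      _ = _ := by
          rw [lintegral_const, Measure.restrict_apply MeasurableSet.univ, univ_inter,
            Real.volume_Ioc, sub_zero]
  -- boundary values
  have hfat := fatou_thm (f := g n) hgd (M := 1) (fun z hz => hgle z hz)
  have hbd : ∀ᵐ θ : ℝ, (‖radialLimit (g n - 1) θ‖₊ : ℝ≥0∞) ^ (2:ℝ) =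
      (‖radialLimit B θ - radialLimit (Bn n) θ‖₊ : ℝ≥0∞) ^ (2:ℝ) := by
    filter_upwards [hfat] with θ hθ
    obtain ⟨L, hL⟩ := hθ
    have hev : ∀ᶠ r : ℝ in 𝓝[<] 1, circlePt r θ ∈ unitDisk := by
      filter_upwards [nhdsWithin_le_nhds (lt_mem_nhds (one_pos (α := ℝ))), self_mem_nhdsWithin]
        with r h0 h1 using circlePt_mem (le_of_lt h0) h1
    have hLg : Tendsto (fun r : ℝ => g n (circlePt r θ)) (𝓝[<] 1) (𝓝 L) := hL
    set P : ℂ := ∏ k ∈ Finset.range n, blaschkeFactor (a k) (circlePt 1 θ) with hP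
    have hn1 : ‖circlePt 1 θ‖ = 1 := circlePt_norm zero_le_one
    have hPn : ‖P‖ = 1 := by
      rw [hP, norm_prod]
      exact Finset.prod_eq_one fun k _ => bl_norm_eq (ha' k).2 (ha' k).1 hn1
    have hLB : Tendsto (fun r : ℝ => Bn n (circlePt r θ)) (𝓝[<] 1) (𝓝 P) := by
      have h1 : ContinuousAt (fun r : ℝ => ∏ k ∈ Finset.range n,
          blaschkeFactor (a k) (circlePt r θ)) 1 := by
        refine tendsto_finsetProd _ fun k _ => ?_
        have h2 : ContinuousAt (fun r : ℝ => circlePt r θ) 1 := by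
          unfold circlePt; fun_prop
        exact ContinuousAt.comp (g := blaschkeFactor (a k)) (f := fun r : ℝ => circlePt r θ)
          (bl_differentiableAt (ha' k).1 hn1.le).continuousAt h2
      refine (h1.tendsto.mono_left nhdsWithin_le_nhds).congr' ?_
      filter_upwards [hev] with r hr using (hBn n _ hr).symm
    have hLBB : Tendsto (fun r : ℝ => B (circlePt r θ)) (𝓝[<] 1) (𝓝 (P * L)) := by
      refine (hLB.mul hLg).congr' ?_
      filter_upwards [hev] with r hr
      rw [hB _ hr, hBn n _ hr, hg n _ hr]
      have h3 := t2 _ hr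
      simp_rw [add_comm n] at h3 ⊢
      exact Multipliable.prod_mul_tprod_nat_mul' h3
    have hLf : Tendsto (fun r : ℝ => (g n - 1) (circlePt r θ)) (𝓝[<] 1) (𝓝 (L - 1)) :=
      hLg.sub_const 1
    rw [radialLimit, radialLimit, radialLimit, hLf.limUnder_eq, hLB.limUnder_eq, hLBB.limUnder_eq]
    have : ‖L - 1‖₊ = ‖P * L - P‖₊ := by
      have h4 : P * L - P = P * (L - 1) := by ring
      apply NNReal.eq
      simp only [coe_nnnorm]
      rw [h4, norm_mul, hPn, one_mul]
    rw [this]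
  have hint := hC₂ _ hH
  rw [lintegral_congr_ae (ae_restrict_of_ae hbd)] at hint
  set J := (∫⁻ θ in Set.Ioc 0 (2 * π),
    (‖radialLimit B θ - radialLimit (Bn n) θ‖₊ : ℝ≥0∞) ^ (2 : ℝ)) / ENNReal.ofReal (2 * π) with hJ
  have hmeas : Measurable (maxRad (g n - 1)) := maxRad_measurable hfd.continuousOn
  have hmain : (∫⁻ θ in Set.Ioc 0 (2 * π), elog1p (maxRad (g n - 1) θ) ^ p) /
      ENNReal.ofReal (2 * π) ≤ ENNReal.ofReal p ^ p * (C₂ * J) ^ (1 / 2 : ℝ) := by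
    calc _ ≤ (∫⁻ θ in Set.Ioc 0 (2 * π), ENNReal.ofReal p ^ p * maxRad (g n - 1) θ) /
          ENNReal.ofReal (2 * π) := by
          gcongr with θ
          exact elog1p_rpow_le hp _
      _ = ENNReal.ofReal p ^ p * ((∫⁻ θ in Set.Ioc 0 (2 * π), maxRad (g n - 1) θ) /
          ENNReal.ofReal (2 * π)) := by
          rw [lintegral_const_mul _ hmeas, mul_div_assoc]
      _ ≤ _ := by
          gcongr
          exact (avg_le_sqrt hmeas).trans (ENNReal.rpow_le_rpow hint (by norm_num))
  have hfin := ENNReal.rpow_le_rpow hmain (z := 1 / p) (by positivity)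
  refine hfin.trans (le_of_eq ?_)
  rw [ENNReal.mul_rpow_of_nonneg _ _ (by positivity), ← ENNReal.rpow_mul, ← ENNReal.rpow_mul,
    mul_one_div_cancel hp0.ne', ENNReal.rpow_one, ENNReal.mul_rpow_of_nonneg _ _ (by positivity),
    mul_assoc, show (1 / 2 * (1 / p) : ℝ) = 1 / (2 * p) by field_simp]
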